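/- Let u, v : ℝ × ℝ → ℝ be smooth functions satisfying u_t = v - u u_x, v_t = -u v_x, let λ ∈ ℝ, and let g̃₁, g̃₂ : ℝ² → ℝ be arbitrary smooth functions. Define f₁(x,t) = g̃₁(u - t v, x - t u + v t²/2) and f₂(x,t) = -t λ g̃₁(u - t v, x - t u + v t²/2) + g̃₂(u - t v, x - t u + v t²/2), where u, v are evaluated at (x,t). Then D_t f₁ = 0 and D_t f₂ = -λ f₁ everywhere, where D_t = ∂/∂t + u ∂/∂x. -/

import Mathlib

/-- Partial derivative in the first (space) variable. -/
noncomputable def pdx (f : ℝ → ℝ → ℝ) : ℝ → ℝ → ℝ := fun x t => deriv (fun y => f y t) x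

/-- Partial derivative in the second (time) variable. -/
noncomputable def pdt (f : ℝ → ℝ → ℝ) : ℝ → ℝ → ℝ := fun x t => deriv (fun s => f x s) t

/-- Smoothness of a function of two real variables. -/
def Smooth2 (f : ℝ → ℝ → ℝ) : Prop := ContDiff ℝ (⊤ : ℕ∞) (fun p : ℝ × ℝ => f p.1 p.2)

theorem Smooth2.hasDerivAt_pdx {f : ℝ → ℝ → ℝ} (hf : Smooth2 f) (x t : ℝ) :
    HasDerivAt (fun y => f y t) (pdx f x t) x := by
  have h : Differentiable ℝ (fun p : ℝ × ℝ => f p.1 p.2) := ContDiff.differentiable hf (by simp)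
  have h' : Differentiable ℝ (fun y => f y t) :=
    h.comp (differentiable_id.prodMk (differentiable_const t))
  exact (h' x).hasDerivAt

theorem Smooth2.hasDerivAt_pdt {f : ℝ → ℝ → ℝ} (hf : Smooth2 f) (x t : ℝ) :
    HasDerivAt (fun s => f x s) (pdt f x t) t := by
  have h : Differentiable ℝ (fun p : ℝ × ℝ => f p.1 p.2) := ContDiff.differentiable hf (by simp)
  have h' : Differentiable ℝ (fun s => f x s) :=
    h.comp ((differentiable_const x).prodMk differentiable_id)
  exact (h' t).hasDerivAt

/-- A differentiable function of the two invariants `u - tv` and `x - tu + vt²/2` has partial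
derivatives in `t` and `x`, and is annihilated by `∂_t + u ∂_x`. -/
theorem exists_hasDerivAt_comp_invariants {u v : ℝ → ℝ → ℝ} {g : ℝ × ℝ → ℝ}
    (hu : Smooth2 u) (hv : Smooth2 v) (hg : Differentiable ℝ g) {x t : ℝ}
    (sys1 : pdt u x t = v x t - u x t * pdx u x t)
    (sys2 : pdt v x t = -(u x t) * pdx v x t) :
    ∃ gt gx : ℝ,
      HasDerivAt (fun s => g (u x s - s * v x s, x - s * u x s + v x s * s ^ 2 / 2)) gt t ∧
      HasDerivAt (fun y => g (u y t - t * v y t, y - t * u y t + v y t * t ^ 2 / 2)) gx x ∧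
      gt + u x t * gx = 0 := by
  have hut := hu.hasDerivAt_pdt x t
  have hvt := hv.hasDerivAt_pdt x t
  have hux := hu.hasDerivAt_pdx x t
  have hvx := hv.hasDerivAt_pdx x t
  have hs := hasDerivAt_id' t
  have h_t := (hut.sub (hs.mul hvt)).prodMk
    (((hs.mul hut).const_sub x).add ((hvt.mul (hs.pow 2)).div_const 2))
  have h_x := (hux.sub (hvx.const_mul t)).prodMk
    (((hasDerivAt_id' x).sub (hux.const_mul t)).add ((hvx.mul_const (t ^ 2)).div_const 2))
  have hL := (hg (u x t - t * v x t, x - t * u x t + v x t * t ^ 2 / 2)).hasFDerivAt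
  refine ⟨_, _, hL.comp_hasDerivAt t h_t, hL.comp_hasDerivAt x h_x, ?_⟩
  rw [← smul_eq_mul (u x t), ← map_smul, ← map_add]
  convert map_zero (fderiv ℝ g (u x t - t * v x t, x - t * u x t + v x t * t ^ 2 / 2)) using 2
  ext
  · simp [sys1, sys2]
    ring
  · simp [sys1, sys2]
    ring

/-- the functional representation of the general solution of the
temporal part of the `N = 2` Lax pair: with `f₁ = g̃₁(u - tv, x - tu + vt²/2)` and
`f₂ = -tλ g̃₁(u - tv, x - tu + vt²/2) + g̃₂(u - tv, x - tu + vt²/2)` one has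
`D_t f₁ = 0` and `D_t f₂ = -λ f₁`, where `D_t = ∂_t + u ∂_x`. -/
theorem statement12 (u v : ℝ → ℝ → ℝ) (lam : ℝ) (g1 g2 : ℝ × ℝ → ℝ)
    (hu : Smooth2 u) (hv : Smooth2 v)
    (hg1 : ContDiff ℝ (⊤ : ℕ∞) g1) (hg2 : ContDiff ℝ (⊤ : ℕ∞) g2)
    (sys1 : ∀ x t, pdt u x t = v x t - u x t * pdx u x t)
    (sys2 : ∀ x t, pdt v x t = -(u x t) * pdx v x t)
    (f₁ f₂ : ℝ → ℝ → ℝ)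
    (hf1 : ∀ x t, f₁ x t = g1 (u x t - t * v x t, x - t * u x t + v x t * t ^ 2 / 2))
    (hf2 : ∀ x t, f₂ x t
      = -t * lam * g1 (u x t - t * v x t, x - t * u x t + v x t * t ^ 2 / 2)
        + g2 (u x t - t * v x t, x - t * u x t + v x t * t ^ 2 / 2)) :
    ∀ x t, pdt f₁ x t + u x t * pdx f₁ x t = 0
      ∧ pdt f₂ x t + u x t * pdx f₂ x t = -lam * f₁ x t := by
  intro x t
  obtain ⟨a, b, ha, hb, hab⟩ := exists_hasDerivAt_comp_invariants hu hv
    (hg1.differentiable (by simp)) (sys1 x t) (sys2 x t)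
  obtain ⟨c, d, hc, hd, hcd⟩ := exists_hasDerivAt_comp_invariants hu hv
    (hg2.differentiable (by simp)) (sys1 x t) (sys2 x t)
  have e1 : pdt f₁ x t = a := by
    simpa only [pdt, hf1] using ha.deriv
  have e2 : pdx f₁ x t = b := by
    simpa only [pdx, hf1] using hb.deriv
  have e3 : pdt f₂ x t = -1 * lam * f₁ x t + -t * lam * a + c := by
    simp only [pdt, hf1, hf2]
    exact ((((hasDerivAt_id' t).neg.mul_const lam).mul ha).add hc).deriv
  have e4 : pdx f₂ x t = -t * lam * b + d := by
    simp only [pdx, hf2]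
    exact ((hb.const_mul (-t * lam)).add hd).deriv
  rw [e1, e2, e3, e4]
  refine ⟨hab, ?_⟩
  linear_combination (-t * lam) * hab + hcd
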